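/- The 2-category of combinatorial categories has products: given a family (K_i, X_i)_{i∈I} of locally presentable categories each equipped with a cofibrantly generated class of cofibrations, the product category ∏ K_i equipped with the componentwise class ∏ X_i is locally presentable and ∏ X_i is cofibrantly generated by a set. -/

import Mathlib

open CategoryTheory Category Limits Opposite

universe w v u u' u''

namespace CellularPaper

variable {K : Type u} [Category.{v} K]

/-- The restriction of a chain `F : J ⥤ K` to the elements below `j`. -/
def restrictionLT {J : Type w} [Preorder J] (F : J ⥤ K) (j : J) :
    {i : J // i < j} ⥤ K :=
  (Monotone.functor (f := fun i : {i : J // i < j} => (i : J)) fun _ _ h => h) ⋙ F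

/-- The cocone on the restriction of `F` below `j` with apex `F.obj j`. -/
@[simps]
def coconeLT {J : Type w} [Preorder J] (F : J ⥤ K) (j : J) :
    Cocone (restrictionLT F j) where
  pt := F.obj j
  ι :=
    { app := fun i => F.map (homOfLE i.2.le)
      naturality := fun i i' h => by
        dsimp [restrictionLT, Monotone.functor]
        rw [← F.map_comp]
        simp }

/-- `f` is a transfinite composite of a smooth chain with links in `C`. -/
def IsTransfiniteCompositionOf (C : MorphismProperty K) : MorphismProperty K :=
  fun A B f =>
    ∃ (J : Type w) (_ : LinearOrder J) (_ : SuccOrder J) (_ : OrderBot J)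
      (_ : WellFoundedLT J) (F : J ⥤ K) (c : Cocone F) (_ : IsColimit c)
      (eA : A ≅ F.obj ⊥) (eB : c.pt ≅ B),
      (∀ j : J, ¬IsMax j → C (F.map (homOfLE (Order.le_succ j)))) ∧
      (∀ j : J, Order.IsSuccLimit j → Nonempty (IsColimit (coconeLT F j))) ∧
      eA.hom ≫ c.ι.app ⊥ ≫ eB.hom = f

/-- A cellular structure: a class of morphisms containing all isomorphisms and closed
under pushout and transfinite composition. -/
structure IsCellular (C : MorphismProperty K) : Prop where
  isos : ∀ {A B : K} (f : A ⟶ B), IsIso f → C f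
  pushout : ∀ {A B A' B' : K} {f : A ⟶ B} {u : A ⟶ A'} {v : B ⟶ B'} {g : A' ⟶ B'},
    IsPushout f u v g → C f → C g
  transfinite : ∀ {A B : K} (f : A ⟶ B), IsTransfiniteCompositionOf.{v} C f → C f

/-- `f` is a retract of `g` in the arrow category. -/
def IsRetractOf {A B X Y : K} (f : A ⟶ B) (g : X ⟶ Y) : Prop :=
  ∃ (u : A ⟶ X) (v : B ⟶ Y) (r : X ⟶ A) (s : Y ⟶ B),
    u ≫ g = f ≫ v ∧ r ≫ f = g ≫ s ∧ u ≫ r = 𝟙 A ∧ v ≫ s = 𝟙 B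

/-- The class of retracts of morphisms in `C`. -/
def retracts (C : MorphismProperty K) : MorphismProperty K :=
  fun _ _ f => ∃ (X Y : K) (g : X ⟶ Y), C g ∧ IsRetractOf f g

/-- The class of pushouts of morphisms in `C`. -/
def Po (C : MorphismProperty K) : MorphismProperty K :=
  fun A' B' g => ∃ (A B : K) (f : A ⟶ B) (u : A ⟶ A') (v : B ⟶ B'),
    C f ∧ IsPushout f u v g

/-- A κ-directed preorder. -/
def IsCardinalDirected (P : Type v) [Preorder P] (κ : Cardinal.{v}) : Prop :=
  ∀ S : Set P, Cardinal.mk S < κ → ∃ p : P, ∀ s ∈ S, s ≤ p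

/-- A κ-presentable object: its hom-functor preserves κ-directed colimits. -/
def IsCardinalPresentable (κ : Cardinal.{v}) (A : K) : Prop :=
  ∀ (P : Type v) (_ : Preorder P), IsCardinalDirected P κ →
    Nonempty (PreservesColimitsOfShape P (coyoneda.obj (op A)))

/-- A locally κ-presentable category. -/
structure IsLocallyPresentable (κ : Cardinal.{v}) (K : Type u) [Category.{v} K] : Prop where
  regular : κ.IsRegular
  hasColimits : HasColimits K
  generators : ∃ (ι : Type v) (G : ι → K), (∀ i, IsCardinalPresentable κ (G i)) ∧
    ∀ X : K, ∃ (P : Type v) (_ : Preorder P) (F : P ⥤ K) (c : Cocone F) (_ : IsColimit c),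
      IsCardinalDirected P κ ∧ Nonempty (c.pt ≅ X) ∧ ∀ p : P, ∃ i, Nonempty (F.obj p ≅ G i)

/-- A locally presentable category. -/
def LocallyPresentable (K : Type u) [Category.{v} K] : Prop :=
  ∃ κ : Cardinal.{v}, IsLocallyPresentable κ K

/-- The smallest cellular class containing `X`. -/
def cellClosure (X : MorphismProperty K) : MorphismProperty K :=
  fun _ _ f => ∀ C : MorphismProperty K, IsCellular C → X ≤ C → C f

/-- `cof(X)`: retracts of transfinite composites of pushouts of `X`. -/
def cofClosure (X : MorphismProperty K) : MorphismProperty K :=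
  retracts (IsTransfiniteCompositionOf.{v} (Po X))

/-- The morphism property generated by a family of morphisms. -/
def ofFamily {ι : Type*} {a b : ι → K} (s : ∀ i, a i ⟶ b i) : MorphismProperty K :=
  fun _ _ f => ∃ i, Nonempty (Arrow.mk f ≅ Arrow.mk (s i))

/-- `C` is cofibrantly generated by a set of morphisms. -/
def IsCofibrantlyGenerated (C : MorphismProperty K) : Prop :=
  ∃ (ι : Type v) (a b : ι → K) (s : ∀ i, a i ⟶ b i),
    C = cofClosure (ofFamily s)

/-- A combinatorial structure on a locally presentable category. -/
structure IsCombinatorial (K : Type u) [Category.{v} K] (C : MorphismProperty K) : Prop where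
  locallyPresentable : LocallyPresentable K
  cellular : IsCellular C
  retractClosed : retracts C ≤ C
  cofibrantlyGenerated : IsCofibrantlyGenerated C

/-- `f` is a transfinite composite of length `< κ` of morphisms in `C`. -/
def IsBoundedTransfiniteCompositionOf (κ : Cardinal.{v}) (C : MorphismProperty K) :
    MorphismProperty K :=
  fun A B f =>
    ∃ (J : Type v) (_ : LinearOrder J) (_ : SuccOrder J) (_ : OrderBot J)
      (_ : WellFoundedLT J), Cardinal.mk J < κ ∧
      ∃ (F : J ⥤ K) (c : Cocone F) (_ : IsColimit c)
        (eA : A ≅ F.obj ⊥) (eB : c.pt ≅ B),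
        (∀ j : J, ¬IsMax j → C (F.map (homOfLE (Order.le_succ j)))) ∧
        (∀ j : J, Order.IsSuccLimit j → Nonempty (IsColimit (coconeLT F j))) ∧
        eA.hom ≫ c.ι.app ⊥ ≫ eB.hom = f

/-- The morphisms of `C` with κ-presentable domain and codomain. -/
def betweenPresentable (κ : Cardinal.{v}) (C : MorphismProperty K) : MorphismProperty K :=
  fun A B f => C f ∧ IsCardinalPresentable κ A ∧ IsCardinalPresentable κ B

/-- `Po_κ(X)`: pushouts of morphisms of `X` between κ-presentable objects. -/
def PoCard (κ : Cardinal.{v}) (X : MorphismProperty K) : MorphismProperty K :=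
  betweenPresentable κ (Po X)

/-- The category `psh(K²)`: objects are morphisms of `K`, morphisms are pushout squares. -/
structure PshArrow (K : Type u) [Category.{v} K] : Type max u v where
  arr : Arrow K

instance : Category.{v} (PshArrow K) where
  Hom g f := {φ : g.arr ⟶ f.arr // IsPushout g.arr.hom φ.left φ.right f.arr.hom}
  id g := ⟨𝟙 _, IsPushout.of_vert_isIso ⟨by simp⟩⟩
  comp φ ψ := ⟨φ.1 ≫ ψ.1, φ.2.paste_vert ψ.2⟩
  id_comp φ := Subtype.ext (Category.id_comp _)
  comp_id φ := Subtype.ext (Category.comp_id _)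
  assoc _ _ _ := Subtype.ext (Category.assoc _ _ _)


section PsPull

variable {K : Type u} {L : Type u'} {M : Type u''}
variable [Category.{v} K] [Category.{v} L] [Category.{v} M]

/-- The pseudopullback of `F : K ⥤ M` and `G : L ⥤ M`. -/
structure PsPull (F : K ⥤ M) (G : L ⥤ M) : Type max u u' v where
  k : K
  l : L
  t : F.obj k ≅ G.obj l

variable {F : K ⥤ M} {G : L ⥤ M}

/-- Morphisms in the pseudopullback. -/
@[ext]
structure PsHom (a b : PsPull F G) : Type v where
  hk : a.k ⟶ b.k
  hl : a.l ⟶ b.l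
  w : F.map hk ≫ b.t.hom = a.t.hom ≫ G.map hl

instance : Category.{v} (PsPull F G) where
  Hom := PsHom
  id a := ⟨𝟙 _, 𝟙 _, by simp⟩
  comp f g := ⟨f.hk ≫ g.hk, f.hl ≫ g.hl, by
    rw [F.map_comp, G.map_comp, Category.assoc, g.w, ← Category.assoc, f.w,
      Category.assoc]⟩

/-- The first projection of the pseudopullback. -/
def projK (F : K ⥤ M) (G : L ⥤ M) : PsPull F G ⥤ K where
  obj a := a.k
  map f := f.hk

/-- The second projection of the pseudopullback. -/
def projL (F : K ⥤ M) (G : L ⥤ M) : PsPull F G ⥤ L where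
  obj a := a.l
  map f := f.hl

/-- `Ps(C, D)`: morphisms of the pseudopullback whose projections lie in `C` and `D`. -/
def PsClass (C : MorphismProperty K) (D : MorphismProperty L) :
    MorphismProperty (PsPull F G) :=
  fun _ _ f => C f.hk ∧ D f.hl

end PsPull


section Extension

open SmallObject.SuccStruct

variable {J : Type w} [LinearOrder J]

/-- The retraction of a linear order onto the lower set `Set.Iic a`. -/
def truncate (a : J) : J →o Set.Iic a where
  toFun j := ⟨min j a, min_le_right j a⟩
  monotone' _ _ h := min_le_min_right a h

lemma map_comp_map_of_preorder {P : Type*} [Preorder P] (E : P ⥤ K) {x y z : P}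
    (f : x ⟶ y) (g : y ⟶ z) (h : x ⟶ z) : E.map f ≫ E.map g = E.map h := by
  rw [← E.map_comp, Subsingleton.elim (f ≫ g) h]

lemma map_comp_map_of_preorder_assoc {P : Type*} [Preorder P] (E : P ⥤ K) {x y z : P}
    (f : x ⟶ y) (g : y ⟶ z) (h : x ⟶ z) {Z : K} (k : E.obj z ⟶ Z) :
    E.map f ≫ E.map g ≫ k = E.map h ≫ k := by
  rw [← assoc, map_comp_map_of_preorder E f g h]

/-- The extension to `J` of a functor on `Set.Iio a` which takes the value `c.pt` from `a` on. -/
def extendByCocone {a : J} {F : Set.Iio a ⥤ K} (c : Cocone F) : J ⥤ K where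
  obj j := (ofCocone c).obj (truncate a j)
  map φ := (ofCocone c).map (homOfLE ((truncate a).monotone (leOfHom φ)))
  map_id j := (ofCocone c).map_id (truncate a j)
  map_comp _ _ := (map_comp_map_of_preorder (ofCocone c) _ _ _).symm

variable {a : J} {F : Set.Iio a ⥤ K} (c : Cocone F)

lemma truncate_of_le {a j : J} (h : j ≤ a) : truncate a j = ⟨j, h⟩ :=
  Subtype.ext (min_eq_left h)

lemma truncate_of_ge {a j : J} (h : a ≤ j) : truncate a j = ⟨a, le_refl a⟩ :=
  Subtype.ext (min_eq_right h)

lemma isIso_extendByCocone_map {i j : J} (φ : i ⟶ j) (hi : a ≤ i) :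
    IsIso ((extendByCocone c).map φ) := by
  have h : truncate a j ≤ truncate a i := by
    rw [truncate_of_ge hi, truncate_of_ge (hi.trans (leOfHom φ))]
  let e : truncate a i ≅ truncate a j :=
    { hom := homOfLE ((truncate a).monotone (leOfHom φ))
      inv := homOfLE h }
  exact inferInstanceAs (IsIso ((ofCocone c).mapIso e).hom)

/-- `extendByCocone c` restricts to `F` below `a`. -/
def extendByCoconeIso :
    (Set.principalSegIio a).monotone.functor ⋙ extendByCocone c ≅ F :=
  NatIso.ofComponents
    (fun i => (ofCocone c).mapIso (eqToIso (truncate_of_le i.2.le)) ≪≫ ofCoconeObjIso c i.1 i.2)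
    (fun {i j} φ => by
      have h₁ := map_comp_map_of_preorder_assoc (ofCocone c)
        (homOfLE ((truncate a).monotone (leOfHom φ)))
        (eqToHom (truncate_of_le j.2.le))
        (homOfLE ((truncate_of_le i.2.le).le.trans (leOfHom φ))) (ofCoconeObjIso c j.1 j.2).hom
      have h₂ := map_comp_map_of_preorder_assoc (ofCocone c)
        (eqToHom (truncate_of_le i.2.le))
        (homOfLE (show (⟨i.1, i.2.le⟩ : Set.Iic a) ≤ ⟨j.1, j.2.le⟩ from leOfHom φ))
        (homOfLE ((truncate_of_le i.2.le).le.trans (leOfHom φ))) (ofCoconeObjIso c j.1 j.2).hom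
      have h₃ := ofCoconeObjIso_hom_naturality c i.1 j.1 (leOfHom φ) j.2
      refine h₁.trans (h₂.symm.trans ?_)
      refine (congrArg (_ ≫ ·) h₃).trans ?_
      exact (assoc _ _ _).symm)

/-- The value of `extendByCocone c` at `a`. -/
def extendByCoconeObjIso : (extendByCocone c).obj a ≅ c.pt :=
  (ofCocone c).mapIso (eqToIso (truncate_of_le le_rfl)) ≪≫ ofCoconeObjIsoPt c

/-- The cocone with apex `c.pt` on the extension. -/
def extendByCoconeCocone : Cocone (extendByCocone c) where
  pt := c.pt
  ι :=
    { app := fun j => (ofCocone c).map (homOfLE (truncate a j).2) ≫ (ofCoconeObjIsoPt c).hom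
      naturality := fun _ _ φ =>
        (map_comp_map_of_preorder_assoc (ofCocone c)
          (homOfLE ((truncate a).monotone (leOfHom φ))) _ _ _).trans (comp_id _).symm }

lemma extendByCoconeIso_hom_app_comp (i : Set.Iio a) :
    (extendByCoconeIso c).hom.app i ≫ c.ι.app i =
      (show (extendByCocone c).obj i.1 ⟶ c.pt from (extendByCoconeCocone c).ι.app i.1) := by
  have h := ofCocone_map_to_top c i.1 i.2
  have h' : (ofCoconeObjIso c i.1 i.2).hom ≫ c.ι.app i =
      (ofCocone c).map (homOfLE i.2.le) ≫ (ofCoconeObjIsoPt c).hom := by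
    rw [h, assoc, assoc, Iso.inv_hom_id, comp_id]
  refine (assoc _ _ _).trans ((congrArg (_ ≫ ·) h').trans ?_)
  exact map_comp_map_of_preorder_assoc (ofCocone c)
    (eqToHom (truncate_of_le i.2.le)) (homOfLE i.2.le) (homOfLE (truncate a i).2) _

lemma isIso_extendByCoconeCocone_ι_app_self :
    IsIso ((extendByCoconeCocone c).ι.app a) :=
  inferInstanceAs (IsIso (extendByCoconeObjIso c).hom)

/-- The restriction of `extendByCoconeCocone c` below `a` is a colimit cocone if `c` is. -/
def isColimitPrincipalSegCocone (hc : IsColimit c) :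
    IsColimit ((Set.principalSegIio a).cocone (extendByCocone c)) := by
  refine IsColimit.equivOfNatIsoOfIso (extendByCoconeIso c).symm c _ ?_ hc
  refine Cocone.ext (extendByCoconeObjIso c).symm fun i => ?_
  have h₁ := extendByCoconeIso_hom_app_comp c i
  have h₂ := (extendByCoconeCocone c).w (homOfLE i.2.le)
  exact (Iso.comp_inv_eq (extendByCoconeObjIso c)).2 (h₁.trans h₂.symm)

lemma isEventuallyConstantFrom_extendByCocone :
    (extendByCocone c).IsEventuallyConstantFrom a :=
  fun _ φ => isIso_extendByCocone_map c φ le_rfl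

/-- The cocone with apex `c.pt` on the extension is a colimit cocone. -/
noncomputable def isColimitExtendByCoconeCocone : IsColimit (extendByCoconeCocone c) :=
  have : Nonempty J := ⟨a⟩
  have := isIso_extendByCoconeCocone_ι_app_self c
  (isEventuallyConstantFrom_extendByCocone c).isColimitOfIsIso _

lemma isWellOrderContinuous_extendByCocone [F.IsWellOrderContinuous] (hc : IsColimit c) :
    (extendByCocone c).IsWellOrderContinuous where
  nonempty_isColimit m hm := by
    rcases lt_trichotomy m a with hma | rfl | hma
    · have := Functor.isWellOrderContinuous_of_iso (extendByCoconeIso c).symm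
      let f : Set.Iio m <i Set.Iio a :=
        { toFun := fun x => ⟨x.1, lt_trans x.2 hma⟩
          inj' := fun x y h => Subtype.ext (congrArg (fun z : Set.Iio a => z.1) h)
          map_rel_iff' := Iff.rfl
          top := ⟨m, hma⟩
          mem_range_iff_rel' := fun b => 
            ⟨by rintro ⟨x, rfl⟩; exact x.2, fun h => ⟨⟨b.1, h⟩, rfl⟩⟩ }
      have hf : Order.IsSuccLimit f.top := by
        refine ⟨fun h => hm.1 fun b hb => ?_, fun b hb => hm.2 b.1 ?_⟩
        · exact h (b := ⟨b, hb.trans_lt hma⟩) hb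
        · refine ⟨hb.1, fun x hx hxm => hb.2 (c := ⟨x, hxm.trans hma⟩) hx hxm⟩
      exact ⟨((Set.principalSegIio a).monotone.functor ⋙
        extendByCocone c).isColimitOfIsWellOrderContinuous' f hf⟩
    · exact ⟨isColimitPrincipalSegCocone c hc⟩
    · have : Nonempty (Set.Iio m) := ⟨⟨a, hma⟩⟩
      have h : ((Set.principalSegIio m).monotone.functor ⋙
          extendByCocone c).IsEventuallyConstantFrom ⟨a, hma⟩ :=
        fun x φ => isIso_extendByCocone_map c (i := a) (j := x.1) (homOfLE (leOfHom φ)) le_rfl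
      have : IsIso (((Set.principalSegIio m).cocone (extendByCocone c)).ι.app ⟨a, hma⟩) :=
        isIso_extendByCocone_map c (homOfLE hma.le) le_rfl
      exact ⟨h.isColimitOfIsIso _⟩

lemma extendByCocone_map_mem_of_lt (W : MorphismProperty K) [W.RespectsIso] {j k : J}
    (hk : k < a) (φ : j ⟶ k)
    (h : W (F.map (homOfLE (leOfHom φ) : (⟨j, (leOfHom φ).trans_lt hk⟩ : Set.Iio a) ⟶ ⟨k, hk⟩))) :
    W ((extendByCocone c).map φ) := by
  refine (W.arrow_mk_iso_iff ?_).2 h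
  exact Arrow.isoMk ((extendByCoconeIso c).app ⟨j, (leOfHom φ).trans_lt hk⟩)
    ((extendByCoconeIso c).app ⟨k, hk⟩)
    ((extendByCoconeIso c).hom.naturality
      (homOfLE (leOfHom φ) : (⟨j, (leOfHom φ).trans_lt hk⟩ : Set.Iio a) ⟶ ⟨k, hk⟩)).symm

lemma isIso_extendByCocone_map_of_covBy (hc : IsColimit c) {j : J} (hj : j ⋖ a) (φ : j ⟶ a) :
    IsIso ((extendByCocone c).map φ) := by
  have ht : IsTerminal (⟨j, hj.lt⟩ : Set.Iio a) :=
    IsTerminal.ofUniqueHom (fun x => homOfLE (hj.le_of_lt x.2)) (fun _ _ => Subsingleton.elim _ _)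
  exact (isColimitPrincipalSegCocone c hc).isIso_ι_app_of_isTerminal _ ht

lemma coe_bot_Iio [OrderBot J] (a : J) [OrderBot (Set.Iio a)] : ((⊥ : Set.Iio a) : J) = ⊥ :=
  le_bot_iff.1 (show (⊥ : Set.Iio a) ≤ ⟨⊥, bot_le.trans_lt (⊥ : Set.Iio a).2⟩ from bot_le)

lemma transfiniteComposition_map_mem_of_covBy {J : Type*} [LinearOrder J] [SuccOrder J]
    [OrderBot J] [WellFoundedLT J] {W : MorphismProperty K} {X Y : K} {f : X ⟶ Y}
    (h : W.TransfiniteCompositionOfShape J f) {j k : J} (hjk : j ⋖ k) (φ : j ⟶ k) :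
    W (h.F.map φ) := by
  obtain rfl := hjk.succ_eq
  exact h.map_mem j hjk.lt.not_isMax

/-- A transfinite composition of shape `Set.Iio a` is also one of shape `J`, with links which may
also be isomorphisms. -/
noncomputable def extendTransfiniteComposition [SuccOrder J] [OrderBot J] [WellFoundedLT J]
    {a : J} [SuccOrder (Set.Iio a)] [OrderBot (Set.Iio a)]
    {W : MorphismProperty K} [W.RespectsIso] {X Y : K} {f : X ⟶ Y}
    (h : W.TransfiniteCompositionOfShape (Set.Iio a) f) :
    (W ⊔ MorphismProperty.isomorphisms K).TransfiniteCompositionOfShape J f where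
  F := extendByCocone (Cocone.mk Y h.incl)
  isoBot := (extendByCocone (Cocone.mk Y h.incl)).mapIso (eqToIso (coe_bot_Iio a).symm) ≪≫
    (extendByCoconeIso (Cocone.mk Y h.incl)).app (⊥ : Set.Iio a) ≪≫ h.isoBot
  isWellOrderContinuous := isWellOrderContinuous_extendByCocone _ h.isColimit
  incl := (extendByCoconeCocone (Cocone.mk Y h.incl)).ι
  isColimit := isColimitExtendByCoconeCocone (Cocone.mk Y h.incl)
  fac := by
    have h₁ := h.fac
    have h₂ := extendByCoconeIso_hom_app_comp (Cocone.mk Y h.incl) ⊥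
    have h₃ := (extendByCoconeCocone (Cocone.mk Y h.incl)).w (eqToHom (coe_bot_Iio a).symm)
    rw [Iso.inv_comp_eq] at h₁ ⊢
    refine h₃.symm.trans ?_
    refine (congrArg (_ ≫ ·) (h₂.symm.trans ((congrArg (_ ≫ ·) h₁).trans (assoc _ _ _).symm))).trans
      (assoc _ _ _).symm
  map_mem j hj := by
    have hcov := Order.covBy_succ_of_not_isMax hj
    rcases lt_or_ge j a with hja | hja
    · rcases (Order.succ_le_of_lt hja).lt_or_eq with hsa | hsa
      · left
        apply extendByCocone_map_mem_of_lt _ _ hsa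
        have hcov' : (⟨j, hja⟩ : Set.Iio a) ⋖ ⟨Order.succ j, hsa⟩ :=
          ⟨hcov.1, fun x hx hx' => hcov.2 (c := x.1) hx hx'⟩
        exact transfiniteComposition_map_mem_of_covBy h hcov' _
      · right
        rw [hsa] at hcov
        have : ∀ (k : J) (hk : k = a) (φ : j ⟶ k),
            IsIso ((extendByCocone (Cocone.mk Y h.incl)).map φ) := by
          rintro _ rfl φ
          exact isIso_extendByCocone_map_of_covBy _ h.isColimit hcov φ
        exact this _ hsa _
    · right
      exact isIso_extendByCocone_map _ _ hja

end Extension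

section Pi

variable {I : Type u''} {D : I → Type u} [∀ i, Category.{v} (D i)]

section

variable {J : Type u'} [Category.{w} J] {F : J ⥤ ∀ i, D i}

/-- A cocone in a product category is a colimit cocone if all its components are. -/
def piIsColimit (c : Cocone F) (h : ∀ i, IsColimit ((Pi.eval D i).mapCocone c)) :
    IsColimit c where
  desc s i := (h i).desc ((Pi.eval D i).mapCocone s)
  fac s j := by
    funext i
    exact (h i).fac ((Pi.eval D i).mapCocone s) j
  uniq s m w := by
    funext i
    exact (h i).uniq ((Pi.eval D i).mapCocone s) (m i) fun j => congr_fun (w j) i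

/-- The cocone in a product category with given components. -/
@[simps]
def piCocone (c : ∀ i, Cocone (F ⋙ Pi.eval D i)) : Cocone F where
  pt i := (c i).pt
  ι :=
    { app := fun j i => (c i).ι.app j
      naturality := fun j j' f => by
        funext i
        exact (c i).ι.naturality f }

/-- The cocone assembled from colimit cocones is a colimit cocone. -/
def piCoconeIsColimit {c : ∀ i, Cocone (F ⋙ Pi.eval D i)} (h : ∀ i, IsColimit (c i)) :
    IsColimit (piCocone c) :=
  piIsColimit _ h

end

lemma pi_hasColimitsOfShape (J : Type u') [Category.{w} J]
    [∀ i, HasColimitsOfShape J (D i)] : HasColimitsOfShape J (∀ i, D i) where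
  has_colimit F := ⟨⟨⟨_, piCoconeIsColimit fun i => colimit.isColimit (F ⋙ Pi.eval D i)⟩⟩⟩

lemma pi_eval_preservesColimitsOfShape (J : Type u') [Category.{w} J]
    [∀ i, HasColimitsOfShape J (D i)] (i : I) :
    PreservesColimitsOfShape J (Pi.eval D i) where
  preservesColimit {F} := preservesColimit_of_preserves_colimit_cocone
    (piCoconeIsColimit fun i => colimit.isColimit (F ⋙ Pi.eval D i))
    (colimit.isColimit (F ⋙ Pi.eval D i))

lemma pi_isPushout {A B A' B' : ∀ i, D i} {f : A ⟶ B} {p : A ⟶ A'} {q : B ⟶ B'} {g : A' ⟶ B'}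
    (h : ∀ i, IsPushout (f i) (p i) (q i) (g i)) : IsPushout f p q g where
  w := funext fun i => (h i).w
  isColimit' := ⟨PushoutCocone.IsColimit.mk _
    (fun s i => (h i).desc (s.inl i) (s.inr i) (congr_fun s.condition i))
    (fun _ => funext fun i => (h i).inl_desc _ _ _)
    (fun _ => funext fun i => (h i).inr_desc _ _ _)
    (fun _ _ h₁ h₂ => funext fun i => (h i).hom_ext
      ((congr_fun h₁ i).trans ((h i).inl_desc _ _ _).symm)
      ((congr_fun h₂ i).trans ((h i).inr_desc _ _ _).symm))⟩

/-- The componentwise class of morphisms of a product category. -/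
def piClass (W : ∀ i, MorphismProperty (D i)) : MorphismProperty (∀ i, D i) :=
  fun _ _ f => ∀ i, W i (f i)

/-- A family of transfinite compositions of the same shape is a transfinite composition. -/
noncomputable def piTransfiniteComposition {J : Type w} [LinearOrder J] [SuccOrder J] [OrderBot J]
    [WellFoundedLT J] {W : ∀ i, MorphismProperty (D i)} {X Y : ∀ i, D i} {f : X ⟶ Y}
    (h : ∀ i, (W i).TransfiniteCompositionOfShape J (f i)) :
    (piClass W).TransfiniteCompositionOfShape J f where
  F := Functor.pi' fun i => (h i).F
  isoBot := Pi.isoMk fun i => (h i).isoBot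
  isWellOrderContinuous :=
    { nonempty_isColimit := fun m hm =>
        ⟨piIsColimit _ fun i => (h i).F.isColimitOfIsWellOrderContinuous m hm⟩ }
  incl := { app := fun j i => (h i).incl.app j
            naturality := fun _ _ φ => funext fun i => (h i).incl.naturality φ }
  isColimit := piIsColimit _ fun i => (h i).isColimit
  fac := funext fun i => (h i).fac
  map_mem j hj i := (h i).map_mem j hj

end Pi

section Cofibrations

lemma isTransfiniteCompositionOf_iff (C : MorphismProperty K) {A B : K} (f : A ⟶ B) :
    IsTransfiniteCompositionOf.{w} C f ↔ MorphismProperty.transfiniteCompositions.{w} C f := by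
  rw [MorphismProperty.transfiniteCompositions_iff]
  constructor
  · rintro ⟨J, _, _, _, _, F, c, hc, eA, eB, hC, hF, fac⟩
    exact ⟨J, inferInstance, inferInstance, inferInstance, inferInstance,
      ⟨{ F := F
         isoBot := eA.symm
         isWellOrderContinuous := ⟨hF⟩
         incl := c.ι ≫ (Functor.const J).map eB.hom
         isColimit := hc.ofIsoColimit (Cocone.ext eB)
         fac := fac
         map_mem := hC }⟩⟩
  · rintro ⟨J, _, _, _, _, ⟨h⟩⟩
    exact ⟨J, inferInstance, inferInstance, inferInstance, inferInstance, h.F, _, h.isColimit,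
      h.isoBot.symm, Iso.refl _, h.map_mem, h.isWellOrderContinuous.nonempty_isColimit, by
        simp⟩

lemma isRetractOf_refl {A B : K} (f : A ⟶ B) : IsRetractOf f f :=
  ⟨𝟙 _, 𝟙 _, 𝟙 _, 𝟙 _, by simp, by simp, by simp, by simp⟩

lemma le_cofClosure (C : MorphismProperty K) : C ≤ cofClosure C := fun A B f hf =>
  ⟨A, B, f, (isTransfiniteCompositionOf_iff _ f).2
    (MorphismProperty.le_transfiniteCompositions _ _
      ⟨A, B, f, 𝟙 _, 𝟙 _, hf, IsPushout.of_vert_isIso ⟨by simp⟩⟩), isRetractOf_refl f⟩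

lemma IsTransfiniteCompositionOf.of_le {C C' : MorphismProperty K} (h : C ≤ C') :
    IsTransfiniteCompositionOf.{w} C ≤ IsTransfiniteCompositionOf.{w} C' := by
  rintro A B f ⟨J, _, _, _, _, F, c, hc, eA, eB, hC, hF, fac⟩
  exact ⟨J, inferInstance, inferInstance, inferInstance, inferInstance, F, c, hc, eA, eB,
    fun j hj => h _ (hC j hj), hF, fac⟩

lemma cofClosure_le {S C : MorphismProperty K} (hS : S ≤ C) (hC : IsCellular C)
    (hC' : retracts C ≤ C) : cofClosure S ≤ C := by
  rintro A B f ⟨X, Y, g, hg, hfg⟩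
  refine hC' _ ⟨X, Y, g, hC.transfinite _ (IsTransfiniteCompositionOf.of_le ?_ _ hg), hfg⟩
  rintro _ _ k ⟨_, _, l, p, q, hl, sq⟩
  exact hC.pushout sq (hS _ hl)

lemma IsCellular.respectsIso {C : MorphismProperty K} (hC : IsCellular C) : C.RespectsIso :=
  .of_respects_arrow_iso _ fun f g e hf =>
    hC.pushout (IsPushout.of_vert_isIso (f := f.hom) (g := e.hom.left) (inl := e.hom.right)
      (inr := g.hom) ⟨e.hom.w.symm⟩) hf

lemma IsCellular.ofFamily_le {C : MorphismProperty K} (hC : IsCellular C) {ι : Type*}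
    {a b : ι → K} {s : ∀ i, a i ⟶ b i} (hs : ∀ i, C (s i)) : ofFamily s ≤ C := by
  rintro A B f ⟨i, ⟨e⟩⟩
  have := hC.respectsIso
  exact (C.arrow_mk_iso_iff e).2 (hs i)

lemma ofFamily_mem {ι : Type*} {a b : ι → K} (s : ∀ i, a i ⟶ b i) (i : ι) : ofFamily s (s i) :=
  ⟨i, ⟨Iso.refl _⟩⟩

lemma exists_isPushout_of_po_ofFamily {ι : Type*} {a b : ι → K} (s : ∀ i, a i ⟶ b i)
    {A B : K} {g : A ⟶ B} (hg : Po (ofFamily s) g) :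
    ∃ (i : ι) (p : a i ⟶ A) (q : b i ⟶ B), IsPushout (s i) p q g := by
  obtain ⟨A', B', f, p, q, ⟨i, ⟨e⟩⟩, sq⟩ := hg
  exact ⟨i, _, _, (IsPushout.of_vert_isIso (f := s i) (g := e.inv.left) (inl := e.inv.right)
      (inr := f) ⟨e.inv.w.symm⟩).paste_vert sq⟩

instance (C : MorphismProperty K) : (Po C).RespectsIso :=
  .of_respects_arrow_iso _ fun f g e ⟨A, B, k, _, _, hk, sq⟩ =>
    ⟨A, B, k, _, _, hk, sq.paste_vert (IsPushout.of_vert_isIso (f := f.hom) (g := e.hom.left)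
      (inl := e.hom.right) (inr := g.hom) ⟨e.hom.w.symm⟩)⟩

/-- A small family of well-ordered types embeds as initial segments `Set.Iio` of one well order. -/
lemma exists_common_wellOrder {I : Type v} (J : I → Type v) [∀ i, LinearOrder (J i)]
    [∀ i, WellFoundedLT (J i)] :
    ∃ (T : Type v) (_ : LinearOrder T) (_ : SuccOrder T) (_ : OrderBot T) (_ : WellFoundedLT T)
      (a : I → T), ∀ i, Nonempty (Set.Iio (a i) ≃o J i) := by
  let o : Ordinal.{v} :=
    Order.succ (⨆ i, Ordinal.type ((· < ·) : J i → J i → Prop))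
  have : Nonempty o.ToType := Ordinal.nonempty_toType_iff.2 (Order.succ_ne_bot _)
  have h (i : I) : Nonempty (J i <i o.ToType) := by
    refine Ordinal.type_lt_iff.1 ?_
    rw [Ordinal.type_toType]
    exact Order.lt_succ_of_le (Ordinal.le_iSup _ i)
  let e (i : I) := (h i).some
  exact ⟨o.ToType, inferInstance, SuccOrder.ofLinearWellFoundedLT _, WellFoundedLT.toOrderBot _,
    inferInstance, fun i => (e i).top, fun i => ⟨(e i).orderIsoIio.symm⟩⟩

variable {I : Type v} {D : I → Type u} [∀ i, Category.{v} (D i)]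
  {C : ∀ i, MorphismProperty (D i)}

lemma retracts_piClass_le (h : ∀ i, retracts (C i) ≤ C i) : retracts (piClass C) ≤ piClass C := by
  rintro A B f ⟨X, Y, g, hg, p, q, r, s, h₁, h₂, h₃, h₄⟩ i
  exact h i _ ⟨X i, Y i, g i, hg i, p i, q i, r i, s i, congr_fun h₁ i, congr_fun h₂ i,
    congr_fun h₃ i, congr_fun h₄ i⟩

lemma isCellular_piClass [∀ i, HasColimits (D i)] (h : ∀ i, IsCellular (C i)) :
    IsCellular (piClass C) where
  isos f hf i := (h i).isos _ ((isIso_pi_iff f).1 hf i)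
  pushout sq hf i := by
    have := pi_eval_preservesColimitsOfShape (D := D) WalkingSpan i
    exact (h i).pushout (sq.map (Pi.eval D i)) (hf i)
  transfinite f hf i := by
    rw [isTransfiniteCompositionOf_iff, MorphismProperty.transfiniteCompositions_iff] at hf
    obtain ⟨J, _, _, _, _, hf⟩ := hf
    have hs (T : Type v) [Preorder T] : PreservesColimitsOfShape T (Pi.eval D i) :=
      have (i : I) : HasColimitsOfShape T (D i) := inferInstance
      pi_eval_preservesColimitsOfShape T i
    have : PreservesWellOrderContinuousOfShape J (Pi.eval D i) :=
      ⟨fun j hj => hs (Set.Iio j)⟩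
    have := hs J
    refine (h i).transfinite _ ((isTransfiniteCompositionOf_iff _ _).2
      ((MorphismProperty.transfiniteCompositions_iff _ _).2
        ⟨J, inferInstance, inferInstance, inferInstance, inferInstance,
          MorphismProperty.transfiniteCompositionsOfShape_map_of_preserves J (Pi.eval D i) f
            (MorphismProperty.transfiniteCompositionsOfShape_monotone J ?_ _ hf)⟩))
    exact fun _ _ g hg => hg i

/-- The sources of the family `s` together with an initial object. -/
noncomputable def withInitialObj [HasInitial K] {ι : Type v} (a : ι → K) : Option ι → K
  | none => ⊥_ K
  | some i => a i

/-- The family `s` together with the identity of an initial object. -/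
noncomputable def withInitial [HasInitial K] {ι : Type v} {a b : ι → K} (s : ∀ i, a i ⟶ b i) :
    ∀ i, withInitialObj a i ⟶ withInitialObj b i
  | none => 𝟙 (⊥_ K)
  | some i => s i

lemma exists_isPushout_withInitial [HasInitial K] {ι : Type v} {a b : ι → K}
    (s : ∀ i, a i ⟶ b i) {A B : K} {g : A ⟶ B}
    (hg : (Po (ofFamily s) ⊔ MorphismProperty.isomorphisms K) g) :
    ∃ (i : Option ι) (p : withInitialObj a i ⟶ A) (q : withInitialObj b i ⟶ B),
      IsPushout (withInitial s i) p q g := by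
  rcases hg with hg | hg
  · obtain ⟨i, p, q, sq⟩ := exists_isPushout_of_po_ofFamily s hg
    exact ⟨some i, p, q, sq⟩
  · have : IsIso g := hg
    exact ⟨none, initial.to A, initial.to B, 
      IsPushout.of_horiz_isIso (f := 𝟙 (⊥_ K)) ⟨by simp⟩⟩

/-- The generators of a product of cofibrantly generated classes. -/
noncomputable def piGenerators [∀ i, HasInitial (D i)] {ι : I → Type v} {a b : ∀ i, ι i → D i}
    (s : ∀ i k, a i k ⟶ b i k) (k : ∀ i, Option (ι i)) :
    (show ∀ i, D i from fun i => withInitialObj (a i) (k i)) ⟶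
      (show ∀ i, D i from fun i => withInitialObj (b i) (k i)) :=
  fun i => withInitial (s i) (k i)

lemma piClass_le_cofClosure [∀ i, HasInitial (D i)] {ι : I → Type v} {a b : ∀ i, ι i → D i}
    (s : ∀ i k, a i k ⟶ b i k) :
    piClass (fun i => cofClosure (ofFamily (s i))) ≤ cofClosure (ofFamily (piGenerators s)) := by
  intro A B f hf
  choose X Y g hg p q r t h₁ h₂ h₃ h₄ using hf
  refine ⟨X, Y, g, ?_, p, q, r, t, funext h₁, funext h₂, funext h₃, funext h₄⟩
  simp only [isTransfiniteCompositionOf_iff, MorphismProperty.transfiniteCompositions_iff] at hg ⊢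
  choose J _ _ _ _ hg using hg
  obtain ⟨T, _, _, _, _, c, e⟩ := exists_common_wellOrder J
  let _ (i : I) : SuccOrder (Set.Iio (c i)) := SuccOrder.ofLinearWellFoundedLT _
  have (i : I) : Nonempty (Set.Iio (c i)) := ⟨(e i).some.symm ⊥⟩
  let _ (i : I) : OrderBot (Set.Iio (c i)) := WellFoundedLT.toOrderBot _
  refine ⟨T, inferInstance, inferInstance, inferInstance, inferInstance,
    ⟨(piTransfiniteComposition (f := g) fun i =>
      extendTransfiniteComposition ((hg i).some.ofOrderIso (e i).some)).ofLE ?_⟩⟩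
  intro U V k hk
  choose l x y sq using fun i => exists_isPushout_withInitial (s i) (hk i)
  exact ⟨_, _, piGenerators s l, x, y, ofFamily_mem _ l, pi_isPushout sq⟩

lemma isCofibrantlyGenerated_piClass [∀ i, HasColimits (D i)] (h : ∀ i, IsCellular (C i))
    (h' : ∀ i, retracts (C i) ≤ C i) (hg : ∀ i, IsCofibrantlyGenerated (C i)) :
    IsCofibrantlyGenerated (piClass C) := by
  choose ι a b s hs using hg
  refine ⟨∀ i, Option (ι i), _, _, piGenerators s, le_antisymm ?_ ?_⟩
  · obtain rfl : C = fun i => cofClosure (ofFamily (s i)) := funext hs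
    exact piClass_le_cofClosure s
  · refine cofClosure_le ((isCellular_piClass h).ofFamily_le fun k i => ?_)
      (isCellular_piClass h) (retracts_piClass_le h')
    show C i (withInitial (s i) (k i))
    cases k i with
    | none => exact (h i).isos _ (inferInstanceAs (IsIso (𝟙 (⊥_ D i))))
    | some l =>
      rw [hs i]
      exact le_cofClosure _ _ (ofFamily_mem (s i) l)

end Cofibrations

section Presentable

lemma isCardinalDirected_iff {P : Type v} [Preorder P] {κ : Cardinal.{v}} [Fact κ.IsRegular] :
    IsCardinalDirected P κ ↔ IsCardinalFiltered P κ := by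
  refine ⟨fun h => isCardinalFiltered_preorder _ _ fun ι f hι => ?_, fun _ S hS => ?_⟩
  · obtain ⟨p, hp⟩ := h (Set.range f) (Cardinal.mk_range_le.trans_lt hι)
    exact ⟨p, fun i => hp _ ⟨i, rfl⟩⟩
  · have hS' : HasCardinalLT S κ := (hasCardinalLT_iff_cardinal_mk_lt _ _).2 hS
    exact ⟨IsCardinalFiltered.max (fun s : S => (s : P)) hS',
      fun s hs => leOfHom (IsCardinalFiltered.toMax (fun s : S => (s : P)) hS' ⟨s, hs⟩)⟩

lemma isCardinalPresentable_iff_mathlib {κ : Cardinal.{v}} [Fact κ.IsRegular] {A : K} :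
    IsCardinalPresentable κ A ↔ CategoryTheory.IsCardinalPresentable A κ := by
  refine ⟨fun h => ⟨fun J _ _ => ?_⟩, fun _ P _ hP => ?_⟩
  · obtain ⟨α, _, hα, F, _⟩ := IsCardinalFiltered.exists_cardinal_directed J κ
    obtain ⟨_⟩ := h α inferInstance (isCardinalDirected_iff.2 hα)
    exact Functor.Final.preservesColimitsOfShape_of_final F _
  · have := isCardinalDirected_iff.1 hP
    exact ⟨preservesColimitsOfShape_of_isCardinalPresentable A κ P⟩

lemma isLocallyPresentable_iff_mathlib {κ : Cardinal.{v}} [Fact κ.IsRegular] :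
    IsLocallyPresentable κ K ↔ IsCardinalLocallyPresentable K κ := by
  refine ⟨fun ⟨_, _, ι, G, hG, hX⟩ => ?_, fun _ => ⟨Fact.out, inferInstance, ?_⟩⟩
  · have hP : (ObjectProperty.ofObj G).isoClosure.IsCardinalFilteredGenerator κ := by
      refine ⟨?_, fun X => ?_⟩
      · rw [ObjectProperty.isoClosure_le_iff]
        rintro _ ⟨i⟩
        exact isCardinalPresentable_iff_mathlib.1 (hG i)
      · obtain ⟨P, _, F, c, hc, hP, ⟨e⟩, hF⟩ := hX X
        refine ⟨P, inferInstance, isCardinalDirected_iff.1 hP,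
          ObjectProperty.prop_of_iso _ e ⟨⟨F, c.ι, hc⟩, fun p => ?_⟩⟩
        obtain ⟨i, ⟨e'⟩⟩ := hF p
        exact ⟨_, ⟨i⟩, ⟨e'⟩⟩
    have := hP.hasCardinalFilteredGenerator
    constructor
  · obtain ⟨P, _, hP⟩ := HasCardinalFilteredGenerator.exists_small_generator K κ
    refine ⟨Shrink.{v} (Subtype P), fun x => ((equivShrink _).symm x).1, fun x =>
      isCardinalPresentable_iff_mathlib.2
        (hP.le_isCardinalPresentable _ ((equivShrink _).symm x).2), fun X => ?_⟩
    obtain ⟨J, _, _, ⟨p⟩⟩ := hP.exists_colimitsOfShape X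
    obtain ⟨α, _, hα, F, _⟩ := IsCardinalFiltered.exists_cardinal_directed J κ
    exact ⟨α, inferInstance, F ⋙ p.diag, p.cocone.whisker F,
      (Functor.Final.isColimitWhiskerEquiv F _).symm p.isColimit, isCardinalDirected_iff.2 hα,
      ⟨Iso.refl _⟩, fun a => ⟨equivShrink _ ⟨_, p.prop_diag_obj (F.obj a)⟩,
        ⟨eqToIso (by simp)⟩⟩⟩

end Presentable

section PiPresentable

variable {I : Type v} {D : I → Type u} [∀ i, Category.{v} (D i)]

/-- The object `A` of `D i`, transported to `D j` along `i = j`. -/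
def castObj {i : I} (A : D i) {j : I} (h : i = j) : D j := h ▸ A

/-- The object of a product category which is `A` in degree `i` and is initial
in the other degrees. -/
noncomputable def piSingle [∀ i, HasColimits (D i)] {i : I} (A : D i) : ∀ i, D i :=
  fun j => ∐ fun h : PLift (i = j) => castObj A h.down

/-- Morphisms from `piSingle A` are morphisms from `A`. -/
noncomputable def piSingleHomEquiv [∀ i, HasColimits (D i)] {i : I} (A : D i) (X : ∀ i, D i) :
    (piSingle A ⟶ X) ≃ (A ⟶ X i) where
  toFun f := Sigma.ι (fun h : PLift (i = i) => castObj A h.down) ⟨rfl⟩ ≫ f i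
  invFun g j := Sigma.desc fun ⟨h⟩ => by
    subst h
    exact g
  left_inv f := by
    funext j
    refine Sigma.hom_ext _ _ ?_
    rintro ⟨rfl⟩
    exact Sigma.ι_desc _ _
  right_inv g := Sigma.ι_desc _ _

lemma piSingleHomEquiv_comp [∀ i, HasColimits (D i)] {i : I} {A : D i} {X Y : ∀ i, D i}
    (f : piSingle A ⟶ X) (g : X ⟶ Y) :
    piSingleHomEquiv A Y (f ≫ g) = piSingleHomEquiv A X f ≫ g i :=
  (Category.assoc _ _ _).symm

/-- `piSingle` is left adjoint to the evaluation. -/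
noncomputable def piSingleAdjunction [∀ i, HasColimits (D i)] (i : I) :
    Adjunction.leftAdjointOfEquiv (G := Pi.eval D i) (fun A X => piSingleHomEquiv A X)
      (fun _ _ _ g f => piSingleHomEquiv_comp f g) ⊣ Pi.eval D i :=
  Adjunction.adjunctionOfEquivLeft _ _

lemma isCardinalPresentable_piSingle [∀ i, HasColimits (D i)] {κ : Cardinal.{v}}
    [Fact κ.IsRegular] {i : I} (A : D i) [CategoryTheory.IsCardinalPresentable A κ] :
    CategoryTheory.IsCardinalPresentable (piSingle A) κ := by
  have : (Pi.eval D i).IsCardinalAccessible κ :=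
    ⟨fun J _ _ => pi_eval_preservesColimitsOfShape J i⟩
  exact (piSingleAdjunction i).isCardinalPresentable_leftAdjoint_obj κ A

lemma isStrongGenerator_piSingle [∀ i, HasColimits (D i)] {P : ∀ i, ObjectProperty (D i)}
    (hP : ∀ i, (P i).IsStrongGenerator) :
    (ObjectProperty.ofObj fun x : Σ i, Subtype (P i) => piSingle x.2.1).IsStrongGenerator := by
  simp only [ObjectProperty.isStrongGenerator_iff] at hP ⊢
  refine ⟨fun X Y f g h => ?_, fun X Y f _ hf => ?_⟩
  · funext i
    refine (hP i).1 _ _ fun G hG s => ?_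
    obtain ⟨t, rfl⟩ := (piSingleHomEquiv G X).surjective s
    rw [← piSingleHomEquiv_comp, ← piSingleHomEquiv_comp,
      h _ (ObjectProperty.ofObj_apply _ (⟨i, G, hG⟩ : Σ i, Subtype (P i))) t]
  · rw [isIso_pi_iff]
    intro i
    have : (Pi.eval D i).IsRightAdjoint := (piSingleAdjunction i).isRightAdjoint
    have : Mono (f i) := inferInstanceAs (Mono ((Pi.eval D i).map f))
    refine (hP i).2 _ fun G hG s => ?_
    obtain ⟨t, rfl⟩ := (piSingleHomEquiv G Y).surjective s
    obtain ⟨r, rfl⟩ := hf _ (ObjectProperty.ofObj_apply _ (⟨i, G, hG⟩ : Σ i, Subtype (P i))) t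
    exact ⟨piSingleHomEquiv G X r, (piSingleHomEquiv_comp r f).symm⟩

lemma isCardinalLocallyPresentable_pi {κ : Cardinal.{v}} [Fact κ.IsRegular]
    [∀ i, IsCardinalLocallyPresentable (D i) κ] :
    IsCardinalLocallyPresentable (∀ i, D i) κ := by
  have this (i) : HasColimits (D i) := inferInstance
  have : HasColimits (∀ i, D i) := ⟨fun J _ => pi_hasColimitsOfShape J⟩
  choose P hP hP' hP'' using fun i =>
    (IsCardinalLocallyPresentable.iff_exists_isStrongGenerator (D i) κ).1 inferInstance
  rw [IsCardinalLocallyPresentable.iff_exists_isStrongGenerator]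
  have this (i) : Small.{v} (Subtype (P i)) := hP i
  refine ⟨_, inferInstance, isStrongGenerator_piSingle hP', ?_⟩
  rintro _ ⟨i, G, hG⟩
  have : CategoryTheory.IsCardinalPresentable G κ := hP'' i _ hG
  exact isCardinalPresentable_piSingle G

lemma locallyPresentable_pi (h : ∀ i, LocallyPresentable (D i)) :
    LocallyPresentable (∀ i, D i) := by
  choose κ hκ using h
  obtain ⟨κ', hκ', hle⟩ := HasCardinalLT.exists_regular_cardinal_forall.{v}
    fun i => (κ i).ord.ToType
  have : Fact κ'.IsRegular := ⟨hκ'⟩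
  have this (i) : IsCardinalLocallyPresentable (D i) κ' := by
    have : Fact (κ i).IsRegular := ⟨(hκ i).regular⟩
    have := isLocallyPresentable_iff_mathlib.1 (hκ i)
    refine IsCardinalLocallyPresentable.of_le (D i) (κ := κ i) (le_of_lt ?_)
    simpa [hasCardinalLT_iff_cardinal_mk_lt] using hle i
  exact ⟨κ', isLocallyPresentable_iff_mathlib.2 isCardinalLocallyPresentable_pi⟩

end PiPresentable

/-- products of combinatorial categories are combinatorial, with the
componentwise class of cofibrations. -/
theorem product_combinatorial (I : Type v) (K : I → Type u)
    [∀ i, Category.{v} (K i)] (C : ∀ i, MorphismProperty (K i))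
    (h : ∀ i, IsCombinatorial (K i) (C i)) :
    IsCombinatorial (∀ i, K i) (fun X Y f => ∀ i, C i ((f : ∀ i, X i ⟶ Y i) i)) := by
  have this (i : I) : HasColimits (K i) := by
    obtain ⟨_, hκ⟩ := (h i).locallyPresentable
    exact hκ.hasColimits
  have hC (i : I) := (h i).cellular
  have hC' (i : I) := (h i).retractClosed
  exact ⟨locallyPresentable_pi fun i => (h i).locallyPresentable, isCellular_piClass hC,
    retracts_piClass_le hC', isCofibrantlyGenerated_piClass hC hC' fun i =>
      (h i).cofibrantlyGenerated⟩

end CellularPaper
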